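/- Let (Δ,Θ) be a directive bi-sequence with associated prefixes (w_n) and let n ≥ 1. Suppose the prefix of length n of (Δ,Θ) is normalized, exactly two pseudopalindromic prefixes v₁, v₂ with |v₁| < |v₂| are missed between w_n and w_{n+1}, and |v₂| < 2|w_n| (i.e. the prefix occurrence of w_n in w_{n+1} overlaps the occurrence of an image of w_n that is a suffix of v₂). Then the suffix of w_n of length 2|w_n| − |v₁| is an image of w_{n−1}; in particular |v₁| = 2|w_n| − |w_{n−1}|. -/

import Mathlib

/-- The ternary alphabet. -/
abbrev Letter := Fin 3

/-- Finite words over the ternary alphabet. -/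
abbrev Word := List Letter

/-- The four involutory antimorphisms of ternary words: the reversal `R`
and, for each letter `i`, the antimorphism `E i`. -/
inductive AM where
  | R : AM
  | E : Letter → AM
deriving DecidableEq

/-- The action of an antimorphism on a single letter: `R` fixes every letter,
and `E i` fixes `i` and exchanges the other two letters (in `Fin 3`,
this involution is `a ↦ -(i + a)`). -/
def AM.letter : AM → Letter → Letter
  | .R, _a => _a
  | .E i, a => -(i + a)

/-- The action of an antimorphism on a word: letterwise image followed by reversal. -/
def AM.apply (t : AM) (w : Word) : Word := (w.map t.letter).reverse

/-- A word is a pseudopalindrome if it is a `ϑ`-palindrome for some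
`ϑ ∈ {R, E_0, E_1, E_2}`. -/
def IsPseudopal (w : Word) : Prop := ∃ t : AM, t.apply w = w

/-- `v` is an image of `w` if `v = ϑ(w)` for some `ϑ ∈ {R, E_0, E_1, E_2}`. -/
def IsImage (w v : Word) : Prop := ∃ t : AM, v = t.apply w

/-- `v` is the `ϑ`-palindromic closure of `u`: the shortest `ϑ`-palindrome
having `u` as a prefix. -/
def IsPalClosure (t : AM) (u v : Word) : Prop :=
  u <+: v ∧ t.apply v = v ∧
    ∀ v' : Word, u <+: v' → t.apply v' = v' → v.length ≤ v'.length

/-- `w` is the sequence of prefixes associated with the directive bi-sequence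
`(Δ, Θ)`: `w 0 = ε` and `w (n+1) = (w n · δ_{n+1})^{ϑ_{n+1}}`. -/
def DirectivePrefixes (Δ : ℕ → Letter) (Θ : ℕ → AM) (w : ℕ → Word) : Prop :=
  w 0 = [] ∧ ∀ n : ℕ, IsPalClosure (Θ (n + 1)) (w n ++ [Δ (n + 1)]) (w (n + 1))

/-- A pseudopalindromic prefix `v` of `w_{n+1}` is missed between `w_n` and `w_{n+1}`
if `|w_n| < |v| < |w_{n+1}|`. -/
def MissedBetween (wn wn1 v : Word) : Prop :=
  v <+: wn1 ∧ IsPseudopal v ∧ wn.length < v.length ∧ v.length < wn1.length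

/-- An image of `u` occurs in `v` at (0-indexed) position `p`. -/
def OccursImageAt (u v : Word) (p : ℕ) : Prop :=
  p + u.length ≤ v.length ∧ IsImage u ((v.drop p).take u.length)

/-- Assumption A for the pair `(wn, wn1)`: some image of `wn` occurs in `wn1`
at a position `p` with `0 < p < |wn1| - |wn|`, overlapping both the prefix
occurrence of `wn` and the suffix occurrence of an image of `wn`. -/
def AssumptionA (wn wn1 : Word) : Prop :=
  ∃ p : ℕ, 0 < p ∧ p < wn1.length - wn.length ∧ p < wn.length ∧
    wn1.length - wn.length < p + wn.length ∧ OccursImageAt wn wn1 p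

/-- The prefix of length `n` of the directive bi-sequence is normalized:
every pseudopalindromic prefix of `w n` equals `w k` for some `k ≤ n`. -/
def NormalizedUpTo (w : ℕ → Word) (n : ℕ) : Prop :=
  ∀ v : Word, v <+: w n → IsPseudopal v → ∃ k : ℕ, k ≤ n ∧ v = w k

/-- `rep u l` is the `l`-fold concatenation `u^l`. -/
def rep (u : Word) (l : ℕ) : Word := (List.replicate l u).flatten

/-- `rmSuf x y` is `x · y⁻¹`: the word `x` with its suffix of length `|y|` removed. -/
def rmSuf (x y : Word) : Word := x.take (x.length - y.length)

/-- `v` is a prefix of the infinite periodic word `pat^ω`. -/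
def IsPrefixOfPow (pat v : Word) : Prop :=
  ∀ q : ℕ, ∀ hq : q < v.length, ∃ hp : q % pat.length < pat.length,
    v.get ⟨q, hq⟩ = pat.get ⟨q % pat.length, hp⟩

theorem AM.letter_letter (t : AM) (a : Letter) : t.letter (t.letter a) = a := by
  cases t with
  | R => rfl
  | E i => revert i a; decide

theorem AM.exists_letter_eq_comp_of_fixed (t s r : AM) (a : Letter)
    (h : t.letter (s.letter (r.letter (t.letter (s.letter (r.letter a))))) = a) :
    ∃ q : AM, ∀ b, q.letter b = t.letter (s.letter (r.letter b)) := by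
  rcases t with _ | i <;> rcases s with _ | j <;> rcases r with _ | k <;>
    simp only [AM.letter] at h ⊢
  · exact ⟨.R, fun _ => rfl⟩
  · exact ⟨.E k, fun _ => rfl⟩
  · exact ⟨.E j, fun _ => rfl⟩
  · refine ⟨.R, ?_⟩
    revert j k a
    decide
  · exact ⟨.E i, fun _ => rfl⟩
  · refine ⟨.R, ?_⟩
    revert i k a
    decide
  · refine ⟨.R, ?_⟩
    revert i j a
    decide
  · refine ⟨.E (i - j + k), ?_⟩
    clear h
    revert i j k
    decide

/-- The letter maps are affine maps of `ℤ/3` with linear part `±1`, so two composites of them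
commute as soon as they commute at one point. -/
theorem AM.letter_comm_of_apply (t s r q : AM) (a : Letter)
    (h : t.letter (s.letter (r.letter (q.letter a))) =
      r.letter (q.letter (t.letter (s.letter a)))) (b : Letter) :
    t.letter (s.letter (r.letter (q.letter b))) =
      r.letter (q.letter (t.letter (s.letter b))) := by
  rcases t with _ | i <;> rcases s with _ | j <;> rcases r with _ | k <;>
    rcases q with _ | l <;> simp only [AM.letter] at h ⊢ <;> grind

/-- The prefix of length `N` of the infinite word `f` is a `t`-palindrome. -/
def IsPalPrefix (f : ℕ → Letter) (t : AM) (N : ℕ) : Prop :=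
  ∀ i j, i + j + 1 = N → f j = t.letter (f i)

theorem AM.length_apply (t : AM) (v : Word) : (t.apply v).length = v.length := by
  simp [AM.apply]

theorem AM.apply_eq_self_iff (t : AM) (v : Word) :
    t.apply v = v ↔ IsPalPrefix (fun i => v.getD i 0) t v.length := by
  constructor
  · intro h i j hij
    have hj : v[j]? = (t.apply v)[j]? := by rw [h]
    have : v.length - 1 - j = i := by omega
    have hi : i < v.length := by omega
    have hj' : j < v.length := by omega
    rw [AM.apply, List.getElem?_reverse (by simpa using hj')] at hj
    simp only [List.length_map, this, List.getElem?_map] at hj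
    simp only [List.getD_eq_getElem?_getD, hj]
    simp [hi]
  · intro h
    refine List.ext_getElem (t.length_apply v) fun j hj hj' => ?_
    have := h (v.length - 1 - j) j (by omega)
    have hi : v.length - 1 - j < v.length := by omega
    simp only [List.getD_eq_getElem?_getD, List.getElem?_eq_getElem hj',
      List.getElem?_eq_getElem hi, Option.getD_some] at this
    simp [AM.apply, this]

theorem AM.apply_eq_self_iff_of_prefix (t : AM) {v z : Word} (h : v <+: z) :
    t.apply v = v ↔ IsPalPrefix (fun i => z.getD i 0) t v.length := by
  obtain ⟨s, rfl⟩ := h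
  rw [AM.apply_eq_self_iff]
  refine forall_congr' fun i => forall_congr' fun j => forall_congr' fun hij => ?_
  beta_reduce
  rw [List.getD_append _ _ _ _ (by omega), List.getD_append _ _ _ _ (by omega)]

theorem IsPalPrefix.isPseudopal_take {z : Word} {t : AM} {N : ℕ} (hN : N ≤ z.length)
    (h : IsPalPrefix (fun i => z.getD i 0) t N) : IsPseudopal (z.take N) := by
  refine ⟨t, (t.apply_eq_self_iff_of_prefix (List.take_prefix N z)).2 ?_⟩
  rwa [List.length_take, min_eq_left hN]

/-- An overlapping occurrence of an image of a pseudopalindromic prefix ends a longer one. -/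
theorem IsPalPrefix.of_overlap {f : ℕ → Letter} {t s r : AM} {N p : ℕ}
    (ht : IsPalPrefix f t N) (hp : p < N)
    (h : ∀ i < N, f (p + i) = s.letter (r.letter (f i))) :
    ∃ q : AM, IsPalPrefix f q (N + p) := by
  have key : ∀ i j, i < N → i + j + 1 = N + p →
      f j = s.letter (r.letter (t.letter (f i))) := by
    intro i j hi hij
    obtain ⟨k, rfl⟩ : ∃ k, j = p + k := ⟨j - p, by omega⟩
    rw [h k (by omega), ht i k (by omega)]
  obtain ⟨q, hq⟩ := AM.exists_letter_eq_comp_of_fixed s r t (f p) (by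
    rw [← key p (N - 1) hp (by omega), ← key (N - 1) p (by omega) (by omega)])
  refine ⟨q, fun i j hij => ?_⟩
  rcases lt_or_ge i N with hi | hi
  · rw [hq, key i j hi hij]
  · rw [key j i (by omega) (by omega), ← hq, q.letter_letter]

/-- Two nested palindromic prefixes give a period up to a permutation of letters. -/
theorem IsPalPrefix.shift {f : ℕ → Letter} {t s : AM} {M N i : ℕ}
    (hM : IsPalPrefix f t M) (hN : IsPalPrefix f s N) (hMN : M ≤ N) (hi : i < M) :
    f (N - M + i) = s.letter (t.letter (f i)) := by
  rw [← hM i (M - 1 - i) (by omega), ← hN (M - 1 - i) (N - M + i) (by omega)]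

/-- The central overlap of two images of a palindromic prefix is an image of a
palindromic prefix. -/
theorem IsPalPrefix.center {f : ℕ → Letter} {t s : AM} {M N : ℕ}
    (hM : IsPalPrefix f t M) (hN : IsPalPrefix f s N) (hMN : M ≤ N) :
    ∃ q : AM, IsPalPrefix f q (2 * M - N) := by
  obtain ⟨q, hq⟩ := AM.exists_letter_eq_comp_of_fixed t s t 0 (by simp [AM.letter_letter])
  refine ⟨q, fun i j hij => ?_⟩
  rw [hq, ← hM.shift hN hMN (by omega), hM (N - M + i) j (by omega)]

theorem DirectivePrefixes.length_strictMono {Δ : ℕ → Letter} {Θ : ℕ → AM} {w : ℕ → Word}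
    (hw : DirectivePrefixes Δ Θ w) : StrictMono fun n => (w n).length := by
  refine strictMono_nat_of_lt_succ fun n => ?_
  have := (hw.2 n).1.length_le
  simp only [List.length_append, List.length_singleton] at this
  omega

theorem DirectivePrefixes.prefix_succ {Δ : ℕ → Letter} {Θ : ℕ → AM} {w : ℕ → Word}
    (hw : DirectivePrefixes Δ Θ w) (n : ℕ) : w n <+: w (n + 1) :=
  (List.prefix_append _ _).trans (hw.2 n).1

theorem DirectivePrefixes.isPseudopal {Δ : ℕ → Letter} {Θ : ℕ → AM} {w : ℕ → Word}
    (hw : DirectivePrefixes Δ Θ w) (n : ℕ) : IsPseudopal (w n) := by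
  cases n with
  | zero => exact ⟨.R, by rw [hw.1]; rfl⟩
  | succ n => exact ⟨_, (hw.2 n).2.1⟩

theorem AM.drop_eq_apply_of_prefix {t : AM} {x u : Word} (hxu : x <+: u)
    (hu : t.apply u = u) : u.drop (u.length - x.length) = t.apply x := by
  obtain ⟨s, rfl⟩ := hxu
  have h : t.apply (x ++ s) = t.apply s ++ t.apply x := by simp [AM.apply]
  have hl : (x ++ s).length - x.length = (t.apply s).length := by
    simp [AM.length_apply]
  rw [hl]
  nth_rewrite 1 [← hu]
  rw [h, List.drop_left]

/-- Lemma: if exactly two pseudopalindromic prefixes `v₁, v₂` (`|v₁| < |v₂|`) are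
missed between `w n` and `w (n+1)` and `|v₂| < 2|w n|`, then the suffix of `w n`
of length `2|w n| - |v₁|` is an image of `w (n-1)`; in particular
`|v₁| = 2|w n| - |w (n-1)|`. -/
theorem overlap_is_image_of_previous_prefix
    (Δ : ℕ → Letter) (Θ : ℕ → AM) (w : ℕ → Word)
    (hw : DirectivePrefixes Δ Θ w) (n : ℕ) (hn : 1 ≤ n)
    (hnorm : NormalizedUpTo w n)
    (v₁ v₂ : Word) (hlen : v₁.length < v₂.length)
    (h₁ : MissedBetween (w n) (w (n + 1)) v₁)
    (h₂ : MissedBetween (w n) (w (n + 1)) v₂)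
    (hexact : ∀ v : Word, MissedBetween (w n) (w (n + 1)) v → v = v₁ ∨ v = v₂)
    (hover : v₂.length < 2 * (w n).length) :
    IsImage (w (n - 1))
        ((w n).drop ((w n).length - (2 * (w n).length - v₁.length))) ∧
      v₁.length = 2 * (w n).length - (w (n - 1)).length := by
  obtain ⟨m, rfl⟩ : ∃ m, n = m + 1 := ⟨n - 1, by omega⟩
  simp only [Nat.add_sub_cancel]
  have hmono := hw.length_strictMono
  set z := w (m + 1 + 1)
  set u := w (m + 1)
  set x := w m
  have hxu : x <+: u := hw.prefix_succ m
  have huz : u <+: z := hw.prefix_succ (m + 1)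
  have hxl : x.length < u.length := hmono m.lt_succ_self
  obtain ⟨tx, htx⟩ : IsPseudopal x := hw.isPseudopal m
  obtain ⟨tu, htu⟩ : IsPseudopal u := hw.isPseudopal (m + 1)
  obtain ⟨hv₁z, ⟨t₁, ht₁⟩, hu₁, h₁z⟩ := h₁
  obtain ⟨hv₂z, ⟨t₂, ht₂⟩, hu₂, h₂z⟩ := h₂
  have hdrop := AM.drop_eq_apply_of_prefix hxu htu
  rw [AM.apply_eq_self_iff_of_prefix _ (hxu.trans huz)] at htx
  rw [AM.apply_eq_self_iff_of_prefix _ huz] at htu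
  rw [AM.apply_eq_self_iff_of_prefix _ hv₁z] at ht₁
  rw [AM.apply_eq_self_iff_of_prefix _ hv₂z] at ht₂
  set f : ℕ → Letter := fun i => z.getD i 0
  have hmissed : ∀ N q, IsPalPrefix f q N → u.length < N → N < z.length →
      N = v₁.length ∨ N = v₂.length := by
    intro N q hq hN hNz
    have hl : (z.take N).length = N := by rw [List.length_take]; omega
    rcases hexact (z.take N) ⟨List.take_prefix _ _, hq.isPseudopal_take hNz.le,
      by omega, by omega⟩ with h | h
    · left; rw [← h, hl]
    · right; rw [← h, hl]
  have hp₂ : v₂.length + u.length = 2 * v₁.length := by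
    obtain ⟨q, hq⟩ := htu.of_overlap (p := v₂.length - v₁.length) (by omega)
      fun i hi => ht₁.shift ht₂ hlen.le (by omega)
    have := hmissed _ q hq (by omega) (by omega)
    omega
  have hle : 2 * u.length - v₁.length ≤ x.length := by
    obtain ⟨q, hq⟩ := htu.center ht₁ hu₁.le
    have hpre : z.take (2 * u.length - v₁.length) <+: u :=
      List.prefix_of_prefix_length_le (List.take_prefix _ _) huz
        (by rw [List.length_take]; omega)
    obtain ⟨k, hk, he⟩ := hnorm _ hpre (hq.isPseudopal_take (by omega))
    have hl : (w k).length = 2 * u.length - v₁.length := by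
      rw [← he, List.length_take]; omega
    have hkm : k ≠ m + 1 := by
      rintro rfl
      change u.length = _ at hl
      omega
    have : (w k).length ≤ x.length := hmono.monotone (show k ≤ m by omega)
    omega
  have hlt : ¬ 2 * u.length - v₁.length < x.length := by
    intro hlt
    have hφ : ∀ i < v₁.length, f (v₁.length - u.length + i) =
        t₂.letter (t₁.letter (f i)) := by
      intro i hi
      rw [← ht₁.shift ht₂ hlen.le hi]
      congr 2; omega
    have hφ₀ : ∀ i < x.length, f (u.length - x.length + i) = tu.letter (tx.letter (f i)) :=
      fun i hi => htx.shift htu hxl.le hi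
    have hcomm := AM.letter_comm_of_apply t₂ t₁ tu tx (f 0) (by
      rw [← hφ₀ 0 (by omega), ← hφ _ (by omega), ← hφ 0 (by omega), ← hφ₀ _ (by omega)]
      congr 1; omega)
    obtain ⟨q, hq⟩ := htu.of_overlap (p := u.length - x.length) (s := tu) (r := tx)
      (by omega) fun i hi => by
        rcases lt_or_ge i x.length with hix | hix
        · exact hφ₀ i hix
        · obtain ⟨k, rfl⟩ : ∃ k, i = v₁.length - u.length + k :=
            ⟨i - (v₁.length - u.length), by omega⟩
          rw [hφ k (by omega), ← hcomm, ← hφ₀ k (by omega), ← hφ _ (by omega)]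
          congr 1; omega
    have := hmissed _ q hq (by omega) (by omega)
    omega
  have hlx : 2 * u.length - v₁.length = x.length := by omega
  exact ⟨⟨tu, by rw [hlx, hdrop]⟩, by omega⟩
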